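/- For all n ≥ 2 and k ≥ 2, there exists a cyclic sequence u_1u_2⋯u_m of length m = C(n+k−1, k) over the alphabet {0,1,…,k} (indices taken modulo m) such that for every position i the cyclic window u_i u_{i+1}⋯u_{i+n−2} of length n−1 has sum at most k, and the map sending position i to the multiset over {1,…,n} in which element l has multiplicity u_{i+l−1} for 1 ≤ l ≤ n−1 and element n has multiplicity k − (u_i + ⋯ + u_{i+n−2}) is a bijection from the m positions onto the collection of all multisets of size k over {1,2,…,n}; that is, a universal cycle for the k-multisets of [n] under shorthand frequency representatives exists. -/

import Mathlib

/-- The cyclic window of length `n` of `u` starting at position `i` (0-based). -/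
def cycWindow (u : List ℕ) (n i : ℕ) : List ℕ :=
  (List.range n).map fun j => u.getD ((i + j) % u.length) 0

/-- Decoding a shorthand frequency representative `f = f_1⋯f_{n-1}`: the
multiset over `{1,…,n}` in which each `i ≤ n−1` has multiplicity `f_i` and `n`
has multiplicity `k − (f_1+⋯+f_{n−1})`. -/
def freqToMultiset (n k : ℕ) (f : List ℕ) : Multiset ℕ :=
  (∑ i ∈ Finset.range (n - 1), Multiset.replicate (f.getD i 0) (i + 1)) +
    Multiset.replicate (k - f.sum) n

open Equiv Equiv.Perm in
theorem sameCycle_mul_swap {α : Type*} [Finite α] [DecidableEq α] {σ : Perm α} {x y : α}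
    (h : ¬ σ.SameCycle x y) : (σ * swap x y).SameCycle x y := by
  have hp : y ∈ Function.periodicPts σ := by
    obtain ⟨m, hm, he⟩ := isOfFinOrder_iff_pow_eq_one.1 (isOfFinOrder_of_finite σ)
    refine ⟨m, hm, ?_⟩
    rw [Function.IsPeriodicPt, Function.IsFixedPt, ← coe_pow, he, one_apply]
  have key : ∀ j < Function.minimalPeriod σ y,
      ((σ * swap x y) ^ (j + 1)) x = (σ ^ (j + 1)) y := by
    intro j
    induction j with
    | zero => intro _; simp
    | succ j ih =>
      intro hj
      rw [pow_succ', mul_apply, ih (by omega), mul_apply, swap_apply_of_ne_of_ne,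
        pow_succ' σ (j + 1), mul_apply]
      · intro he
        exact h (SameCycle.symm ⟨(j + 1 : ℕ), by rw [zpow_natCast, he]⟩)
      · intro he
        refine Function.not_isPeriodicPt_of_pos_of_lt_minimalPeriod (by omega) hj ?_
        rwa [Function.IsPeriodicPt, Function.IsFixedPt, ← coe_pow]
  have hpos := Function.minimalPeriod_pos_of_mem_periodicPts hp
  refine ⟨(Function.minimalPeriod σ y : ℕ), ?_⟩
  have := key (Function.minimalPeriod σ y - 1) (by omega)
  rw [Nat.sub_add_cancel hpos] at this
  rw [zpow_natCast, this, coe_pow, Function.iterate_minimalPeriod]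

open Equiv Equiv.Perm in
theorem Equiv.Perm.SameCycle.mul_swap {α : Type*} [Finite α] [DecidableEq α] {σ : Perm α}
    {x y a b : α} (h : ¬ σ.SameCycle x y) (hab : σ.SameCycle a b) :
    (σ * swap x y).SameCycle a b := by
  have hxy := sameCycle_mul_swap h
  have step : ∀ z, (σ * swap x y).SameCycle z (σ z) := by
    intro z
    rcases eq_or_ne z x with rfl | hx
    · exact hxy.trans ⟨1, by simp⟩
    rcases eq_or_ne z y with rfl | hy
    · exact hxy.symm.trans ⟨1, by simp⟩
    · exact ⟨1, by simp [swap_apply_of_ne_of_ne hx hy]⟩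
  obtain ⟨m, rfl⟩ := hab.exists_nat_pow_eq
  induction m with
  | zero => exact SameCycle.refl _ _
  | succ m ih =>
    rw [pow_succ', mul_apply]
    exact (ih ⟨m, by simp⟩).trans (step _)

open Equiv Equiv.Perm in
/-- If the graph joining `x` to `y` whenever `P x = P y` or `P x = Q y` is connected, then some
permutation among those with `Q ∘ σ = P` has a single cycle, provided there are any. -/
theorem exists_perm_forall_sameCycle {α β : Type*} [Finite α] (P Q : α → β)
    (hne : ∃ σ : Perm α, ∀ x, Q (σ x) = P x)
    (hconn : ∀ r : Setoid α, (∀ x y, P x = P y → r x y) → (∀ x y, P x = Q y → r x y) →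
      ∀ x y, r x y) :
    ∃ σ : Perm α, (∀ x, Q (σ x) = P x) ∧ ∀ x y, σ.SameCycle x y := by
  classical
  obtain ⟨σ, hσ, hmax⟩ := Set.exists_max_image {σ : Perm α | ∀ x, Q (σ x) = P x}
    (fun σ => {p : α × α | σ.SameCycle p.1 p.2}.ncard) (Set.toFinite _) hne
  have hP : ∀ x y, P x = P y → σ.SameCycle x y := by
    intro x y hxy
    by_contra h
    refine (hmax (σ * swap x y) fun z => ?_).not_gt (Set.ncard_lt_ncard ?_ (Set.toFinite _))
    · rw [mul_apply, hσ]
      rcases eq_or_ne z x with rfl | hx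
      · simp [hxy]
      rcases eq_or_ne z y with rfl | hy
      · simp [hxy]
      · rw [swap_apply_of_ne_of_ne hx hy]
    · exact ⟨fun p hp => SameCycle.mul_swap h hp,
        fun hs => h (hs (sameCycle_mul_swap h : (x, y) ∈ _))⟩
  refine ⟨σ, hσ, hconn (SameCycle.setoid σ) hP fun x y hxy => ?_⟩
  obtain ⟨z, rfl⟩ := σ.surjective y
  exact (hP x z (by rw [hxy, hσ])).trans ⟨1, by simp⟩

theorem ncard_multisets_Icc (n k : ℕ) (hn : 1 ≤ n) :
    {m : Multiset ℕ | Multiset.card m = k ∧ ∀ x ∈ m, 1 ≤ x ∧ x ≤ n}.ncard =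
      Nat.choose (n + k - 1) k := by
  have : NeZero n := ⟨by omega⟩
  have himage : {m : Multiset ℕ | Multiset.card m = k ∧ ∀ x ∈ m, 1 ≤ x ∧ x ≤ n} =
      Set.range fun s : Sym (Fin n) k => s.1.map fun i : Fin n => (i : ℕ) + 1 := by
    ext m
    constructor
    · rintro ⟨hc, hm⟩
      refine ⟨⟨m.map fun x => Fin.ofNat n (x - 1), by simp [hc]⟩, ?_⟩
      simp only [Multiset.map_map]
      conv_rhs => rw [← Multiset.map_id m]
      refine Multiset.map_congr rfl fun x hx => ?_
      have := hm x hx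
      simp only [Function.comp_apply, Fin.val_ofNat, id_eq]
      rw [Nat.mod_eq_of_lt (by omega)]
      omega
    · rintro ⟨s, rfl⟩
      refine ⟨by simp, fun x hx => ?_⟩
      obtain ⟨i, -, rfl⟩ := Multiset.mem_map.1 hx
      have := i.2
      omega
  rw [himage, ← Set.image_univ, Set.ncard_image_of_injective, Set.ncard_univ,
    Nat.card_eq_fintype_card, Sym.card_sym_eq_choose, Fintype.card_fin]
  intro s t hst
  refine Sym.coe_injective (Multiset.map_injective (fun i j hij => ?_) hst)
  exact Fin.ext (by simpa using hij)

theorem count_freqToMultiset {n k : ℕ} {f : List ℕ} {i : ℕ} (hi : i < n - 1) :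
    (freqToMultiset n k f).count (i + 1) = f.getD i 0 := by
  rw [freqToMultiset, Multiset.count_add, Multiset.count_sum', Multiset.count_replicate,
    if_neg (by omega), Finset.sum_eq_single i]
  · simp
  · intro j _ hj
    rw [Multiset.count_replicate, if_neg (by omega)]
  · simp [hi]

theorem sum_range_getD {f : List ℕ} : ∑ i ∈ Finset.range f.length, f.getD i 0 = f.sum := by
  rw [Finset.sum_range, ← Fin.sum_univ_getElem]
  exact Finset.sum_congr rfl fun i _ => by simp

theorem bijOn_freqToMultiset (n k : ℕ) (hn : 1 ≤ n) :
    Set.BijOn (freqToMultiset n k) {f : List ℕ | f.length = n - 1 ∧ f.sum ≤ k}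
      {m : Multiset ℕ | Multiset.card m = k ∧ ∀ x ∈ m, 1 ≤ x ∧ x ≤ n} := by
  have hmaps : Set.MapsTo (freqToMultiset n k) {f : List ℕ | f.length = n - 1 ∧ f.sum ≤ k}
      {m : Multiset ℕ | Multiset.card m = k ∧ ∀ x ∈ m, 1 ≤ x ∧ x ≤ n} := by
    rintro f ⟨hl, hs⟩
    refine ⟨?_, fun x hx => ?_⟩
    · rw [freqToMultiset, Multiset.card_add, Multiset.card_sum]
      simp only [Multiset.card_replicate]
      rw [← hl, sum_range_getD]
      omega
    · rw [freqToMultiset, Multiset.mem_add, Multiset.mem_sum] at hx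
      rcases hx with ⟨i, hi, hx⟩ | hx
      · have := Multiset.eq_of_mem_replicate hx
        have := Finset.mem_range.1 hi
        omega
      · have := Multiset.eq_of_mem_replicate hx
        omega
  have hcard : ∀ m : Multiset ℕ, Multiset.card m = k ∧ (∀ x ∈ m, 1 ≤ x ∧ x ≤ n) →
      ∑ i ∈ Finset.range (n - 1), m.count (i + 1) + m.count n = k := by
    rintro m ⟨hc, hm⟩
    have := Multiset.sum_count_eq_card (s := Finset.range (n + 1)) (m := m)
      fun x hx => by simpa [Nat.lt_succ_iff] using (hm x hx).2
    obtain ⟨d, rfl⟩ : ∃ d, n = d + 1 := ⟨n - 1, by omega⟩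
    have h0 : m.count 0 = 0 := Multiset.count_eq_zero.2 fun h => by simpa using (hm 0 h).1
    rw [Finset.sum_range_succ', h0, Finset.sum_range_succ, hc] at this
    simpa using this
  refine ⟨hmaps, ?_, ?_⟩
  · rintro f ⟨hfl, -⟩ g ⟨hgl, -⟩ hfg
    refine List.ext_getElem (hfl.trans hgl.symm) fun i hi hi' => ?_
    have := congrArg (Multiset.count (i + 1)) hfg
    rwa [count_freqToMultiset (by omega), count_freqToMultiset (by omega),
      List.getD_eq_getElem _ _ hi, List.getD_eq_getElem _ _ hi'] at this
  · intro m hm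
    have hsum : ((List.range (n - 1)).map fun i => m.count (i + 1)).sum + m.count n = k := by
      rw [← hcard m hm]
      rfl
    have hf : (List.range (n - 1)).map (fun i => m.count (i + 1)) ∈
        {f : List ℕ | f.length = n - 1 ∧ f.sum ≤ k} := ⟨by simp, by omega⟩
    refine ⟨_, hf, ?_⟩
    have hm' := hmaps hf
    have hlt : ∀ i < n - 1, (freqToMultiset n k
        ((List.range (n - 1)).map fun i => m.count (i + 1))).count (i + 1) = m.count (i + 1) := by
      intro i hi
      rw [count_freqToMultiset hi, List.getD_eq_getElem _ _ (by simpa using hi)]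
      simp
    ext x
    by_cases hx : 1 ≤ x ∧ x ≤ n
    · rcases hx.2.lt_or_eq with h | rfl
      · obtain ⟨i, rfl⟩ : ∃ i, x = i + 1 := ⟨x - 1, by omega⟩
        exact hlt i (by omega)
      · have h1 := hcard _ hm'
        rw [Finset.sum_congr rfl fun i hi => hlt i (Finset.mem_range.1 hi)] at h1
        have h2 := hcard _ hm
        omega
    · rw [Multiset.count_eq_zero_of_notMem fun h => hx (hm'.2 x h),
        Multiset.count_eq_zero_of_notMem fun h => hx (hm.2 x h)]

/-- The words of length `d` over `ℕ` whose letters sum to at most `k`. -/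
abbrev BoundedWord (d k : ℕ) := {f : List ℕ // f.length = d ∧ f.sum ≤ k}

theorem exists_perm_words_forall_sameCycle (d k : ℕ) :
    ∃ σ : Equiv.Perm (BoundedWord d k),
      (∀ x, (σ x).1.dropLast = x.1.tail) ∧ ∀ x y, σ.SameCycle x y := by
  have : Finite (BoundedWord d k) :=
    (bijOn_freqToMultiset (d + 1) k (by omega)).finite_iff_finite.2
      (Set.finite_of_ncard_pos (by
        rw [ncard_multisets_Icc _ _ (by omega)]
        exact Nat.choose_pos (by omega)))
  refine exists_perm_forall_sameCycle (fun x : BoundedWord d k => x.1.tail) (fun x => x.1.dropLast) ?_ ?_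
  · let rot : BoundedWord d k → BoundedWord d k :=
      fun x => ⟨x.1.rotate 1, by simp [x.2.1], by
        rw [((List.rotate_perm x.1 1).sum_eq)]; exact x.2.2⟩
    have hrot : Function.Injective rot := fun x y hxy =>
      Subtype.ext (List.rotate_injective 1 (congrArg Subtype.val hxy))
    refine ⟨Equiv.ofBijective rot (Finite.injective_iff_bijective.1 hrot), fun x => ?_⟩
    obtain ⟨_ | ⟨a, l⟩, hx⟩ := x <;> simp [rot]
  · intro r hP hQ
    have pad : ∀ l : List ℕ, ∀ (hl : l.length ≤ d) (hs : l.sum ≤ k),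
        r ⟨List.replicate d 0, by simp⟩
          ⟨List.replicate (d - l.length) 0 ++ l, by simp [hl], by simpa using hs⟩ := by
      intro l
      induction l using List.reverseRecOn with
      | nil => intro _ _; simp
      | append_singleton l a ih =>
        intro hl hs
        simp only [List.length_append, List.length_singleton, List.sum_append] at hl hs
        refine r.trans (ih (by omega) (by omega)) (hQ _ _ ?_)
        obtain ⟨e, rfl⟩ : ∃ e, d = e + l.length + 1 := ⟨d - l.length - 1, by omega⟩
        have h1 : e + l.length + 1 - l.length = e + 1 := by omega
        have h2 : e + l.length + 1 - (l ++ [a]).length = e := by simp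
        simp only [h1, h2, List.replicate_succ, List.cons_append, List.tail_cons,
          ← List.append_assoc, List.dropLast_concat]
    have zero : ∀ y, r ⟨List.replicate d 0, by simp⟩ y := by
      rintro ⟨y, rfl, hy⟩
      simpa using pad y le_rfl hy
    exact fun x y => r.trans (r.symm (zero x)) (zero y)

/-- For all `n ≥ 2` and `k ≥ 2`, there exists a cyclic
sequence `u_1⋯u_m` of length `m = C(n+k−1, k)` over the alphabet `{0,…,k}` such
that every cyclic window of length `n−1` has sum at most `k`, and the map
sending position `i` to the multiset over `{1,…,n}` in which element
`l ≤ n−1` has multiplicity `u_{i+l−1}` and element `n` has multiplicity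
`k − (u_i+⋯+u_{i+n−2})` is a bijection from the `m` positions onto the
multisets of size `k` over `{1,…,n}`; that is, a universal cycle for the
`k`-multisets of `[n]` under shorthand frequency representatives exists. -/
theorem stmt15 (n k : ℕ) (hn : 2 ≤ n) (hk : 2 ≤ k) :
    ∃ u : List ℕ, u.length = Nat.choose (n + k - 1) k ∧
      (∀ x ∈ u, x ≤ k) ∧
      (∀ i < u.length, (cycWindow u (n - 1) i).sum ≤ k) ∧
      Set.BijOn (fun i : ℕ => freqToMultiset n k (cycWindow u (n - 1) i))
        {i : ℕ | i < u.length}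
        {m : Multiset ℕ | Multiset.card m = k ∧ ∀ x ∈ m, 1 ≤ x ∧ x ≤ n} := by
  have hwords := bijOn_freqToMultiset n k (by omega)
  obtain ⟨σ, hσ, hcyc⟩ := exists_perm_words_forall_sameCycle (n - 1) k
  set m := Nat.choose (n + k - 1) k with hm
  have hm0 : 0 < m := Nat.choose_pos (by omega)
  have hcard : Nat.card (BoundedWord (n - 1) k) = m := by
    rw [hm, ← ncard_multisets_Icc n k (by omega), ← Set.ncard_congr' hwords.equiv]
    rfl
  have : Finite (BoundedWord (n - 1) k) := Nat.finite_of_card_ne_zero (by omega)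
  have := Fintype.ofFinite (BoundedWord (n - 1) k)
  rw [Nat.card_eq_fintype_card, ← Finset.card_univ] at hcard
  have hon : σ.IsCycleOn (Finset.univ : Finset (BoundedWord (n - 1) k)) := by
    refine ⟨by simp, fun x _ y _ => hcyc x y⟩
  let z : (BoundedWord (n - 1) k) := ⟨List.replicate (n - 1) 0, by simp⟩
  have hperiod : (σ ^ m) z = z := hcard ▸ hon.pow_card_apply (Finset.mem_univ z)
  have hmod : ∀ i, (σ ^ (i % m)) z = (σ ^ i) z := fun i => by
    conv_rhs => rw [← Nat.mod_add_div i m, pow_add, pow_mul, Equiv.Perm.mul_apply,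
      Equiv.Perm.pow_apply_eq_self_of_apply_eq_self hperiod]
  have hsurj : Set.SurjOn (fun i => (σ ^ i) z) (Finset.range m) (Finset.univ : Finset (BoundedWord (n - 1) k)) := by
    intro y _
    obtain ⟨i, hi, rfl⟩ := hon.exists_pow_eq (Finset.mem_univ z) (Finset.mem_univ y)
    exact ⟨i, by simpa [hcard] using hi, rfl⟩
  have hinj : Set.InjOn (fun i => (σ ^ i) z) (Finset.range m) :=
    Finset.injOn_of_surjOn_of_card_le _ (fun _ _ => by simp) hsurj (by simp [hcard])
  have hshift : ∀ j i, j < n - 1 → ((σ ^ (i + j)) z).1.getD 0 0 = ((σ ^ i) z).1.getD j 0 := by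
    intro j
    induction j with
    | zero => simp
    | succ j ih =>
      intro i hj
      rw [show i + (j + 1) = i + 1 + j by omega, ih (i + 1) (by omega), pow_succ',
        Equiv.Perm.mul_apply]
      have h := congrArg (fun l => l[j]?) (hσ ((σ ^ i) z))
      have hl := (σ ((σ ^ i) z)).2.1
      simp only [List.getElem?_tail, List.getElem?_dropLast, hl] at h
      rw [if_pos (by omega)] at h
      simp [List.getD_eq_getElem?_getD, h]
  set u : List ℕ := (List.range m).map fun i => ((σ ^ i) z).1.getD 0 0 with hu
  have hlen : u.length = m := by simp [hu]
  have hwin : ∀ i, cycWindow u (n - 1) i = ((σ ^ i) z).1 := by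
    intro i
    have hl := ((σ ^ i) z).2.1
    refine List.ext_getElem (by simp [cycWindow, hl]) fun j hj hj' => ?_
    have hlt : (i + j) % m < u.length := by rw [hlen]; exact Nat.mod_lt _ hm0
    simp only [cycWindow, List.getElem_map, List.getElem_range]
    rw [hlen, List.getD_eq_getElem _ _ hlt]
    simp only [hu, List.getElem_map, List.getElem_range]
    rw [hmod, hshift j i (by omega), List.getD_eq_getElem _ _ hj']
  refine ⟨u, hlen, fun x hx => ?_, fun i _ => ?_, ?_⟩
  · obtain ⟨i, -, rfl⟩ := List.mem_map.1 hx
    have hl := ((σ ^ i) z).2.1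
    rw [List.getD_eq_getElem _ _ (by omega)]
    exact (List.single_le_sum (by simp) _ (List.getElem_mem _)).trans ((σ ^ i) z).2.2
  · rw [hwin]
    exact ((σ ^ i) z).2.2
  · simp only [hwin, hlen]
    refine hwords.comp (g := freqToMultiset n k) (f := fun i => ((σ ^ i) z).1)
      ⟨fun i _ => ((σ ^ i) z).2, fun i hi j hj hij => ?_, fun y hy => ?_⟩
    · exact hinj (by simpa using hi) (by simpa using hj) (Subtype.ext hij)
    · obtain ⟨i, hi, he⟩ := hsurj (Finset.mem_coe.2 (Finset.mem_univ ⟨y, hy⟩))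
      exact ⟨i, by simpa using hi, congrArg Subtype.val he⟩
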